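/- For every integer n ≥ 4, the number of partitions λ = (λ_1 ≥ ... ≥ λ_n ≥ 0) with n parts and |λ| = d for which there exists an index i with λ_i = λ_{i+1} = λ_{i+2}, λ_{i−1} − λ_i ≥ 3 if i ≥ 2, and λ_j − λ_{j+1} ≥ 2 for all j with j ≤ i−2 or i+2 ≤ j ≤ n−1, satisfies the generating function identity Σ_{d=0}^∞ #{such λ} q^d = (q^{(n-1)(n-3)}/(q)_n) · Σ_{i=0}^{n-3} q^{3i}(1−q^{n-2-i})(1−q^{n-1-i}), as formal power series in q, where (q)_n = ∏_{j=1}^n (1 − q^j) and division means multiplication by the inverse of this unit in the formal power series ring. -/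

import Mathlib

open Finset

/-- A partition with `n` (possibly zero) parts, encoded as a weakly decreasing function
`ℕ → ℕ` (0-indexed: `l 0, …, l (n-1)` are the parts `λ_1, …, λ_n`) vanishing from index `n` on. -/
def PartitionN (n : ℕ) (l : ℕ → ℕ) : Prop :=
  Antitone l ∧ ∀ j, n ≤ j → l j = 0

/-- `(q)_s = ∏_{j=1}^s (1 - q^j)` as a formal power series over `ℚ`. -/
noncomputable def qPoch (s : ℕ) : PowerSeries ℚ :=
  ∏ j ∈ Finset.range s, (1 - (PowerSeries.X : PowerSeries ℚ) ^ (j + 1))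

/-- Case-2 condition (0-based index `i`): `λ_i = λ_{i+1} = λ_{i+2}`, `λ_{i-1} - λ_i ≥ 3`
if `i ≥ 1` (0-based), and `λ_j - λ_{j+1} ≥ 2` for `j ≤ i-2` or `j ≥ i+2` (0-based). -/
def Case2 (n : ℕ) (l : ℕ → ℕ) : Prop :=
  ∃ i : ℕ, i + 3 ≤ n ∧ l i = l (i + 1) ∧ l (i + 1) = l (i + 2) ∧
    (1 ≤ i → l i + 3 ≤ l (i - 1)) ∧
    (∀ j, j + 1 < n → (j + 2 ≤ i ∨ i + 2 ≤ j) → l (j + 1) + 2 ≤ l j)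

/-- The partitions of `d` with `n` parts whose consecutive differences satisfy `p`. -/
def partitionsWithDiff (n : ℕ) (p : ℕ → ℕ → Prop) (d : ℕ) : Set (ℕ → ℕ) :=
  {l | PartitionN n l ∧ (∑ j ∈ range n, l j) = d ∧ ∀ j < n, p j (l j - l (j + 1))}

/-- The vector of weighted differences `(j + 1) (λ_j - λ_{j+1})` of a partition. -/
noncomputable def weightedDiff (n : ℕ) (l : ℕ → ℕ) : ℕ →₀ ℕ :=
  Finsupp.indicator (range n) fun j _ => (j + 1) * (l j - l (j + 1))

theorem weightedDiff_apply_of_lt {n j : ℕ} (l : ℕ → ℕ) (hj : j < n) :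
    weightedDiff n l j = (j + 1) * (l j - l (j + 1)) :=
  Finsupp.indicator_of_mem (mem_range.2 hj) _

theorem sum_weighted_diff {l : ℕ → ℕ} (hl : Antitone l) (n : ℕ) :
    ∑ j ∈ range n, (j + 1) * (l j - l (j + 1)) + n * l n = ∑ j ∈ range n, l j := by
  induction n with
  | zero => simp
  | succ n ih =>
    rw [sum_range_succ, sum_range_succ, ← ih]
    obtain ⟨k, hk⟩ := Nat.exists_eq_add_of_le (hl n.le_succ)
    simp only [Nat.succ_eq_add_one] at hk
    rw [hk, Nat.add_sub_cancel_left]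
    ring

theorem PartitionN.eq_of_diff_eq {n : ℕ} {l m : ℕ → ℕ} (hl : PartitionN n l) (hm : PartitionN n m)
    (h : ∀ j < n, l j - l (j + 1) = m j - m (j + 1)) : l = m := by
  funext j
  by_cases hj : n ≤ j
  · rw [hl.2 j hj, hm.2 j hj]
  · refine Nat.decreasingInduction (motive := fun k _ => l k = m k) (fun k hk ih => ?_) ?_
      (not_le.1 hj).le
    · have h1 := h k hk
      have h2 := hl.1 k.le_succ
      have h3 := hm.1 k.le_succ
      simp only [Nat.succ_eq_add_one] at h2 h3
      omega
    · rw [hl.2 n le_rfl, hm.2 n le_rfl]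

theorem exists_partitionN_diff_eq (n : ℕ) (c : ℕ → ℕ) :
    ∃ l, PartitionN n l ∧ ∀ j < n, l j - l (j + 1) = c j := by
  refine ⟨fun j => ∑ k ∈ Ico j n, c k, ⟨fun a b hab => ?_, fun j hj => ?_⟩, fun j hj => ?_⟩
  · exact sum_le_sum_of_subset (Ico_subset_Ico_left hab)
  · simp [hj]
  · simp only [sum_eq_sum_Ico_succ_bot hj, Nat.add_sub_cancel_right]

open Classical in
theorem bijOn_weightedDiff (n : ℕ) (p : ℕ → ℕ → Prop) (d : ℕ) :
    Set.BijOn (weightedDiff n) (partitionsWithDiff n p d)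
      ((finsuppAntidiag (range n) d).filter
        fun c => ∀ j ∈ range n, ∃ k, p j k ∧ c j = (j + 1) * k : Finset (ℕ →₀ ℕ)) := by
  refine ⟨?_, ?_, ?_⟩
  · rintro l ⟨hl, hd, hp⟩
    simp only [coe_filter, mem_finsuppAntidiag, Set.mem_ofPred_eq, mem_range]
    refine ⟨⟨?_, Finsupp.support_indicator_subset _ _⟩, fun j hj =>
      ⟨_, hp j hj, weightedDiff_apply_of_lt l hj⟩⟩
    rw [← hd, ← sum_weighted_diff hl.1, hl.2 n le_rfl, mul_zero, add_zero]
    exact sum_congr rfl fun j hj => weightedDiff_apply_of_lt l (mem_range.1 hj)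
  · rintro l ⟨hl, -, -⟩ m ⟨hm, -, -⟩ h
    refine hl.eq_of_diff_eq hm fun j hj => Nat.eq_of_mul_eq_mul_left j.succ_pos ?_
    simpa only [weightedDiff_apply_of_lt _ hj] using DFunLike.congr_fun h j
  · intro c hc
    simp only [coe_filter, mem_finsuppAntidiag, Set.mem_ofPred_eq, mem_range] at hc
    obtain ⟨⟨hsum, hsupp⟩, hp⟩ := hc
    choose! k hk hck using hp
    obtain ⟨l, hl, hdiff⟩ := exists_partitionN_diff_eq n k
    refine ⟨l, ⟨hl, ?_, fun j hj => hdiff j hj ▸ hk j hj⟩, ?_⟩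
    · rw [← hsum, ← sum_weighted_diff hl.1, hl.2 n le_rfl, mul_zero, add_zero]
      refine sum_congr rfl fun j hj => ?_
      rw [hdiff j (mem_range.1 hj), hck j (mem_range.1 hj)]
    · ext j
      by_cases hj : j < n
      · rw [weightedDiff_apply_of_lt l hj, hdiff j hj, hck j hj]
      · rw [weightedDiff, Finsupp.indicator_of_notMem (by simpa using hj)]
        exact (Finsupp.notMem_support_iff.1 fun h => hj (mem_range.1 (hsupp h))).symm

theorem finite_partitionsWithDiff (n : ℕ) (p : ℕ → ℕ → Prop) (d : ℕ) :
    (partitionsWithDiff n p d).Finite := by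
  classical
  exact (bijOn_weightedDiff n p d).finite_iff_finite.2 (finite_toSet _)

open Classical in
/-- The generating function `∑ q^(s k)` over all `k` satisfying `P`. -/
noncomputable def multiplesSeries (s : ℕ) (P : ℕ → Prop) : PowerSeries ℚ :=
  PowerSeries.mk fun m => if ∃ k, P k ∧ m = s * k then 1 else 0

theorem mk_ncard_partitionsWithDiff (n : ℕ) (p : ℕ → ℕ → Prop) :
    PowerSeries.mk (fun d => ((partitionsWithDiff n p d).ncard : ℚ)) =
      ∏ j ∈ range n, multiplesSeries (j + 1) (p j) := by
  classical
  ext d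
  rw [PowerSeries.coeff_prod, PowerSeries.coeff_mk, (bijOn_weightedDiff n p d).ncard_eq,
    Set.ncard_coe_finset, card_filter]
  push_cast
  refine sum_congr rfl fun c _ => ?_
  simp only [multiplesSeries, PowerSeries.coeff_mk, prod_boole]

theorem multiplesSeries_eq_zero (s : ℕ) : multiplesSeries s (fun k => k = 0) = 1 := by
  ext m
  simp [multiplesSeries, PowerSeries.coeff_one]

theorem multiplesSeries_le_mul {s : ℕ} (hs : 0 < s) (a : ℕ) :
    multiplesSeries s (fun k => a ≤ k) * (1 - PowerSeries.X ^ s) = PowerSeries.X ^ (s * a) := by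
  ext m
  rw [mul_sub, mul_one, map_sub, PowerSeries.coeff_mul_X_pow', PowerSeries.coeff_X_pow]
  simp only [multiplesSeries, PowerSeries.coeff_mk]
  by_cases hdvd : s ∣ m
  · obtain ⟨t, rfl⟩ := hdvd
    have h1 : ∀ t, (∃ k, a ≤ k ∧ s * t = s * k) ↔ a ≤ t := fun t =>
      ⟨fun ⟨k, hk, h⟩ => Nat.eq_of_mul_eq_mul_left hs h ▸ hk, fun h => ⟨t, h, rfl⟩⟩
    have h2 : s ≤ s * t ↔ 1 ≤ t := by
      conv_lhs => lhs; rw [← mul_one s]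
      exact Nat.mul_le_mul_left_iff hs
    have h3 : s * t - s = s * (t - 1) := by rw [Nat.mul_sub, mul_one]
    have h4 : s * t = s * a ↔ t = a := Nat.mul_right_inj hs.ne'
    simp only [h3, h1, h2, h4]
    split_ifs <;> first | omega | norm_num
  · have h1 : ¬ ∃ k, a ≤ k ∧ m = s * k := fun ⟨k, _, h⟩ => hdvd ⟨k, h⟩
    have h2 : s ≤ m → ¬ ∃ k, a ≤ k ∧ m - s = s * k := fun hm ⟨k, _, h⟩ =>
      hdvd ⟨k + 1, by rw [mul_add, mul_one]; omega⟩
    have h3 : m ≠ s * a := fun h => hdvd ⟨a, h⟩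
    rw [if_neg h1, if_neg h3]
    split_ifs with hm hk
    · exact absurd hk (h2 hm)
    · simp
    · simp

/-- The lower bound on `λ_j - λ_{j+1}` in the case-2 condition with index `i`. -/
def diffBound (n i j : ℕ) : ℕ :=
  if j = i ∨ j = i + 1 ∨ j + 1 = n then 0 else if j + 1 = i then 3 else 2

/-- The condition on `k = λ_j - λ_{j+1}` in the case-2 condition with index `i`. -/
def DiffCond (n i j k : ℕ) : Prop :=
  if j = i ∨ j = i + 1 then k = 0 else diffBound n i j ≤ k

theorem case2_iff_exists_diffCond {n : ℕ} {l : ℕ → ℕ} (hl : PartitionN n l) :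
    Case2 n l ↔ ∃ i < n - 2, ∀ j < n, DiffCond n i j (l j - l (j + 1)) := by
  have hanti : ∀ j, l (j + 1) ≤ l j := fun j => hl.1 j.le_succ
  constructor
  · rintro ⟨i, hi, h1, h2, h3, h4⟩
    refine ⟨i, by omega, fun j hj => ?_⟩
    unfold DiffCond diffBound
    split_ifs with ha hb hc
    · rcases ha with rfl | rfl
      · omega
      · rw [← h2, Nat.sub_self]
    · omega
    · subst hc
      have := h3 (by omega)
      rw [Nat.add_sub_cancel] at this
      omega
    · have := h4 j (by omega) (by omega)
      omega
  · rintro ⟨i, hi, h⟩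
    have h1 := h i (by omega)
    have h2 := h (i + 1) (by omega)
    simp only [DiffCond, true_or, or_true, if_true] at h1 h2
    have h3 := hanti i
    have h4 : l (i + 2) ≤ l (i + 1) := hanti (i + 1)
    replace h2 : l (i + 1) - l (i + 2) = 0 := h2
    refine ⟨i, by omega, by omega, by omega, fun hi1 => ?_, fun j hj hji => ?_⟩
    · obtain ⟨i, rfl⟩ := Nat.exists_eq_add_of_le' hi1
      have h3 := h i (by omega)
      rw [DiffCond, if_neg (by omega), diffBound, if_neg (by omega), if_pos rfl] at h3
      rw [Nat.add_sub_cancel]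
      omega
    · have h3 := h j (by omega)
      rw [DiffCond, if_neg (by omega), diffBound, if_neg (by omega), if_neg (by omega)] at h3
      omega

theorem diffCond_index_unique {n i i' : ℕ} {c : ℕ → ℕ} (hi : i < n - 2) (hi' : i' < n - 2)
    (h : ∀ j < n, DiffCond n i j (c j)) (h' : ∀ j < n, DiffCond n i' j (c j)) : i = i' := by
  have key : ∀ {i i' : ℕ}, i < n - 2 → (∀ j < n, DiffCond n i j (c j)) →
      (∀ j < n, DiffCond n i' j (c j)) → i' ≤ i := by
    intro i i' hi h h'
    by_contra! hlt
    have h1 := h i (by omega)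
    have h2 := h' i (by omega)
    rw [DiffCond, if_pos (Or.inl rfl)] at h1
    rw [DiffCond, if_neg (by omega), diffBound, if_neg (by omega)] at h2
    split_ifs at h2 <;> omega
  exact le_antisymm (key hi' h' h) (key hi h h')

theorem ncard_case2 (n d : ℕ) :
    {l : ℕ → ℕ | PartitionN n l ∧ (∑ j ∈ range n, l j) = d ∧ Case2 n l}.ncard =
      ∑ i ∈ range (n - 2), (partitionsWithDiff n (DiffCond n i) d).ncard := by
  have hunion : {l : ℕ → ℕ | PartitionN n l ∧ (∑ j ∈ range n, l j) = d ∧ Case2 n l} =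
      ⋃ i ∈ (range (n - 2) : Set ℕ), partitionsWithDiff n (DiffCond n i) d := by
    ext l
    simp only [partitionsWithDiff, Set.mem_iUnion, Set.mem_ofPred_eq, coe_range, Set.mem_Iio,
      exists_prop]
    constructor
    · rintro ⟨hl, hd, hc⟩
      obtain ⟨i, hi, h⟩ := (case2_iff_exists_diffCond hl).1 hc
      exact ⟨i, hi, hl, hd, h⟩
    · rintro ⟨i, hi, hl, hd, h⟩
      exact ⟨hl, hd, (case2_iff_exists_diffCond hl).2 ⟨i, hi, h⟩⟩
  rw [hunion, (finite_toSet _).ncard_biUnion (fun i _ => finite_partitionsWithDiff n _ d),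
    finsum_mem_coe_finset]
  intro i hi i' hi' hne
  refine Set.disjoint_left.2 fun l hl hl' => hne ?_
  exact diffCond_index_unique (by simpa using hi) (by simpa using hi') hl.2.2 hl'.2.2

theorem sum_mul_diffBound {n i : ℕ} (hi : i + 3 ≤ n) :
    ∑ j ∈ range n, (j + 1) * diffBound n i j = (n - 1) * (n - 3) + 3 * (n - 3 - i) := by
  have hsum : ∑ j ∈ range n, (j + 1) * diffBound n i j + 2 * (i + 1) + 2 * (i + 2) + 2 * n =
      n * (n + 1) + i := by
    have hterm : ∀ j ∈ range n, (j + 1) * diffBound n i j + (if j = i then 2 * (j + 1) else 0) +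
        (if j = i + 1 then 2 * (j + 1) else 0) + (if j = n - 1 then 2 * (j + 1) else 0) =
        2 * (j + 1) + (if j + 1 = i then j + 1 else 0) := by
      intro j _
      unfold diffBound
      split_ifs <;> omega
    have h := sum_congr rfl hterm
    simp only [sum_add_distrib, sum_ite_eq', mem_range] at h
    rw [if_pos (by omega), if_pos (by omega), if_pos (by omega)] at h
    have h1 : ∑ j ∈ range n, (if j + 1 = i then j + 1 else 0) = i := by
      have := sum_range_succ' (fun j => if j = i then j else 0) n
      simp only [sum_ite_eq', mem_range] at this
      rw [if_pos (by omega)] at this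
      simpa using this.symm
    have h2 : ∑ j ∈ range n, 2 * (j + 1) = n * (n + 1) := by
      have := sum_range_id_mul_two (n + 1)
      rw [sum_range_succ'] at this
      rw [← mul_sum, mul_comm n, mul_comm 2]
      simpa using this
    rw [← mul_sum, sum_add_distrib] at h2
    rw [h1] at h
    have h3 : n - 1 + 1 = n := by omega
    rw [h3] at h
    simp only [← mul_sum, sum_add_distrib] at h
    omega
  obtain ⟨m, rfl⟩ := Nat.exists_eq_add_of_le' hi
  have e1 : m + (i + 3) - 1 = m + i + 2 := by omega
  have e2 : m + (i + 3) - 3 = m + i := by omega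
  have e3 : m + i - i = m := by omega
  rw [e1, e2, e3]
  nlinarith

theorem multiplesSeries_diffCond_mul (n i j : ℕ) :
    multiplesSeries (j + 1) (DiffCond n i j) * (1 - PowerSeries.X ^ (j + 1)) =
      PowerSeries.X ^ ((j + 1) * diffBound n i j) *
        ((if j = i then 1 - PowerSeries.X ^ (j + 1) else 1) *
          (if j = i + 1 then 1 - PowerSeries.X ^ (j + 1) else 1)) := by
  by_cases h : j = i ∨ j = i + 1
  · have h1 : DiffCond n i j = fun k => k = 0 := by
      funext k
      rw [DiffCond, if_pos h]
    have h2 : diffBound n i j = 0 := if_pos (by tauto)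
    rw [h1, h2, multiplesSeries_eq_zero]
    rcases h with rfl | rfl <;> simp
  · have h1 : DiffCond n i j = fun k => diffBound n i j ≤ k := by
      funext k
      rw [DiffCond, if_neg h]
    rw [not_or] at h
    rw [h1, multiplesSeries_le_mul j.succ_pos, if_neg h.1, if_neg h.2, mul_one, mul_one]

theorem prod_multiplesSeries_mul_qPoch {n i : ℕ} (hi : i + 3 ≤ n) :
    (∏ j ∈ range n, multiplesSeries (j + 1) (DiffCond n i j)) * qPoch n =
      PowerSeries.X ^ ((n - 1) * (n - 3) + 3 * (n - 3 - i)) *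
        ((1 - PowerSeries.X ^ (i + 1)) * (1 - PowerSeries.X ^ (i + 2))) := by
  rw [qPoch, ← prod_mul_distrib, prod_congr rfl fun j _ => multiplesSeries_diffCond_mul n i j,
    prod_mul_distrib, prod_mul_distrib, prod_pow_eq_pow_sum, sum_mul_diffBound hi, prod_ite_eq',
    prod_ite_eq', if_pos (mem_range.2 (by omega)), if_pos (mem_range.2 (by omega))]

theorem constantCoeff_qPoch (n : ℕ) : PowerSeries.constantCoeff (qPoch n) = 1 := by
  simp [qPoch]

theorem case2_generating_function (n : ℕ) (hn : 4 ≤ n) :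
    PowerSeries.mk (fun d => (Set.ncard {l : ℕ → ℕ | PartitionN n l ∧
        (∑ j ∈ Finset.range n, l j) = d ∧ Case2 n l} : ℚ)) =
      PowerSeries.X ^ ((n - 1) * (n - 3)) * (qPoch n)⁻¹ *
        ∑ i ∈ Finset.range (n - 2), PowerSeries.X ^ (3 * i) *
          (1 - PowerSeries.X ^ (n - 2 - i)) * (1 - PowerSeries.X ^ (n - 1 - i)) := by
  have hq : PowerSeries.constantCoeff (qPoch n) ≠ 0 := by simp [constantCoeff_qPoch]
  have hmk : PowerSeries.mk (fun d => (Set.ncard {l : ℕ → ℕ | PartitionN n l ∧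
      (∑ j ∈ Finset.range n, l j) = d ∧ Case2 n l} : ℚ)) =
      ∑ i ∈ range (n - 2), ∏ j ∈ range n, multiplesSeries (j + 1) (DiffCond n i j) := by
    simp only [← mk_ncard_partitionsWithDiff]
    ext d
    simp [ncard_case2]
  rw [mul_right_comm, hmk, PowerSeries.eq_mul_inv_iff_mul_eq hq, sum_mul, mul_sum,
    ← sum_range_reflect]
  refine sum_congr rfl fun i hi => ?_
  rw [mem_range] at hi
  have e1 : n - 3 - (n - 2 - 1 - i) = i := by omega
  have e2 : n - 2 - 1 - i + 1 = n - 2 - i := by omega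
  have e3 : n - 2 - 1 - i + 2 = n - 1 - i := by omega
  rw [prod_multiplesSeries_mul_qPoch (by omega), e1, e2, e3, pow_add]
  ring
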